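/- arXiv:1709.07778 — 2 statements merged into one kernel-verified Lean document; each statement's English description precedes it below -/
import Mathlib

section
/- Fix γ > 0 and set σ_{Z1}² = γσ1²/(γ + σ1²). Let θ̂1 : ℝ^{2p} → ℝ^p be measurable, let X = (X1, X2) with X1 ~ N_p(θ1, σ1² I_p), X2 ~ N_p(θ2, σ2² I_p) independent, and let Z = (Z1, Z2) with Z1 ~ N_p(θ1, σ_{Z1}² I_p), Z2 ~ N_p(θ2, σ2² I_p) independent. Then for every θ = (θ1, θ2), E[ (1 − e^{−‖θ̂1(X) − θ1‖²/(2γ)}) ] − E[ (1 − e^{−‖X1 − θ1‖²/(2γ)}) ] ≤ (1/(2γ)) · (γ/(γ + σ1²))^{p/2} · ( E‖θ̂1(Z) − θ1‖² − E‖Z1 − θ1‖² ). In particular, if θ̂1(Z) dominates Z1 as an estimator of θ1 under squared error loss over {θ : θ1 − θ2 ∈ A}, then θ̂1(X) dominates X1 under the reflected normal loss 1 − e^{−‖d − θ1‖²/(2γ)} over the same restricted parameter space. -/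
open MeasureTheory Real Set

noncomputable section

abbrev Ep (p : ℕ) := EuclideanSpace ℝ (Fin p)

/-- Density of `N_p(0, v I_p)` evaluated at `u`. -/
def gdens (p : ℕ) (v : ℝ) (u : Ep p) : ℝ :=
  (2 * Real.pi * v) ^ (-(p : ℝ) / 2) * Real.exp (-‖u‖ ^ 2 / (2 * v))

/-- Joint density of a pair of independent Gaussians. -/
def jointDens (p : ℕ) (v1 v2 : ℝ) (θ1 θ2 : Ep p) (x : Ep p × Ep p) : ℝ :=
  gdens p v1 (x.1 - θ1) * gdens p v2 (x.2 - θ2)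

theorem gdens_nonneg (p : ℕ) {v : ℝ} (hv : 0 < v) (u : Ep p) : 0 ≤ gdens p v u := by
  unfold gdens; positivity

theorem continuous_gdens (p : ℕ) (v : ℝ) : Continuous (gdens p v) := by
  unfold gdens; fun_prop

theorem integrable_exp_neg_mul_norm_sq (p : ℕ) {b : ℝ} (hb : 0 < b) :
    Integrable (fun u : Ep p => Real.exp (-b * ‖u‖ ^ 2)) := by
  have h := (GaussianFourier.integrable_cexp_neg_mul_sq_norm_add (V := Ep p)
    (b := (b : ℂ)) (by simpa using hb) 0 0).norm
  refine h.congr (Filter.Eventually.of_forall fun u => ?_)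
  simp only [Complex.norm_exp, inner_zero_left]
  congr 1
  simp [← Complex.ofReal_pow]

theorem integrable_gdens (p : ℕ) {v : ℝ} (hv : 0 < v) : Integrable (gdens p v) := by
  refine ((integrable_exp_neg_mul_norm_sq p (b := 1 / (2 * v)) (by positivity)).const_mul
    ((2 * Real.pi * v) ^ (-(p : ℝ) / 2))).congr (Filter.Eventually.of_forall fun u => ?_)
  simp only [gdens]
  congr 2
  ring

theorem integrable_norm_sq_mul_gdens (p : ℕ) {v : ℝ} (hv : 0 < v) :
    Integrable (fun u : Ep p => ‖u‖ ^ 2 * gdens p v u) := by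
  refine ((integrable_exp_neg_mul_norm_sq p (b := 1 / (4 * v)) (by positivity)).const_mul
    ((2 * Real.pi * v) ^ (-(p : ℝ) / 2) * (4 * v))).mono'
    (by have := continuous_gdens p v; fun_prop) (Filter.Eventually.of_forall fun u => ?_)
  rw [Real.norm_of_nonneg (mul_nonneg (by positivity) (gdens_nonneg p hv u))]
  have hle : ‖u‖ ^ 2 ≤ 4 * v * Real.exp (‖u‖ ^ 2 / (4 * v)) := by
    have := Real.add_one_le_exp (‖u‖ ^ 2 / (4 * v))
    calc ‖u‖ ^ 2 = 4 * v * (‖u‖ ^ 2 / (4 * v)) := by field_simp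
      _ ≤ _ := by gcongr; linarith
  have hexp : Real.exp (‖u‖ ^ 2 / (4 * v)) * Real.exp (-‖u‖ ^ 2 / (2 * v)) =
      Real.exp (-(1 / (4 * v)) * ‖u‖ ^ 2) := by
    rw [← Real.exp_add]
    congr 1
    field_simp
    ring
  calc ‖u‖ ^ 2 * gdens p v u
      ≤ 4 * v * Real.exp (‖u‖ ^ 2 / (4 * v)) * gdens p v u :=
        mul_le_mul_of_nonneg_right hle (gdens_nonneg p hv u)
    _ = (2 * Real.pi * v) ^ (-(p : ℝ) / 2) * (4 * v) *
        (Real.exp (‖u‖ ^ 2 / (4 * v)) * Real.exp (-‖u‖ ^ 2 / (2 * v))) := by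
        unfold gdens; ring
    _ = _ := by rw [hexp]

theorem jointDens_nonneg (p : ℕ) {v1 v2 : ℝ} (h1 : 0 < v1) (h2 : 0 < v2) (θ1 θ2 : Ep p)
    (x : Ep p × Ep p) : 0 ≤ jointDens p v1 v2 θ1 θ2 x :=
  mul_nonneg (gdens_nonneg p h1 _) (gdens_nonneg p h2 _)

theorem integrable_jointDens (p : ℕ) {v1 v2 : ℝ} (h1 : 0 < v1) (h2 : 0 < v2) (θ1 θ2 : Ep p) :
    Integrable (jointDens p v1 v2 θ1 θ2) :=
  ((integrable_gdens p h1).comp_sub_right θ1).mul_prod ((integrable_gdens p h2).comp_sub_right θ2)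

theorem integrable_norm_sq_mul_jointDens (p : ℕ) {v1 v2 : ℝ} (h1 : 0 < v1) (h2 : 0 < v2)
    (θ1 θ2 : Ep p) :
    Integrable (fun z : Ep p × Ep p => ‖z.1 - θ1‖ ^ 2 * jointDens p v1 v2 θ1 θ2 z) := by
  refine (((integrable_norm_sq_mul_gdens p h1).comp_sub_right θ1).mul_prod
    ((integrable_gdens p h2).comp_sub_right θ2)).congr (Filter.Eventually.of_forall fun z => ?_)
  simp only [jointDens, mul_assoc]

/-- Tilting a centred Gaussian by a Gaussian kernel shrinks its variance. -/
theorem exp_mul_gdens (p : ℕ) {v γ : ℝ} (hv : 0 < v) (hγ : 0 < γ) (u : Ep p) :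
    Real.exp (-‖u‖ ^ 2 / (2 * γ)) * gdens p v u =
      (γ / (γ + v)) ^ ((p : ℝ) / 2) * gdens p (γ * v / (γ + v)) u := by
  have hc : (2 * Real.pi * v) ^ (-(p : ℝ) / 2) =
      (γ / (γ + v)) ^ ((p : ℝ) / 2) * (2 * Real.pi * (γ * v / (γ + v))) ^ (-(p : ℝ) / 2) := by
    rw [show 2 * Real.pi * (γ * v / (γ + v)) = γ / (γ + v) * (2 * Real.pi * v) by ring,
      Real.mul_rpow (x := γ / (γ + v)) (by positivity) (by positivity), ← mul_assoc,
      ← Real.rpow_add (by positivity), neg_div, add_neg_cancel, Real.rpow_zero, one_mul]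
  have he : Real.exp (-‖u‖ ^ 2 / (2 * γ)) * Real.exp (-‖u‖ ^ 2 / (2 * v)) =
      Real.exp (-‖u‖ ^ 2 / (2 * (γ * v / (γ + v)))) := by
    rw [← Real.exp_add]
    congr 1
    field_simp
    ring
  simp only [gdens]
  rw [← mul_assoc ((γ / (γ + v)) ^ ((p : ℝ) / 2)), ← hc, ← he]
  ring

theorem integrable_reflectedNormalLoss (p : ℕ) {v1 v2 γ : ℝ} (h1 : 0 < v1) (h2 : 0 < v2)
    (hγ : 0 < γ) (θ1 θ2 : Ep p) {f : Ep p × Ep p → Ep p} (hf : Measurable f) :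
    Integrable (fun x : Ep p × Ep p =>
      (1 - Real.exp (-‖f x - θ1‖ ^ 2 / (2 * γ))) * jointDens p v1 v2 θ1 θ2 x) := by
  refine (integrable_jointDens p h1 h2 θ1 θ2).bdd_mul (c := 1)
    (by fun_prop : Measurable fun x => 1 - Real.exp (-‖f x - θ1‖ ^ 2 / (2 * γ))).aestronglyMeasurable
    (Filter.Eventually.of_forall fun x => ?_)
  have hle : Real.exp (-‖f x - θ1‖ ^ 2 / (2 * γ)) ≤ 1 := by
    rw [Real.exp_le_one_iff, neg_div]
    exact neg_nonpos.2 (by positivity)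
  have hpos := Real.exp_pos (-‖f x - θ1‖ ^ 2 / (2 * γ))
  rw [Real.norm_eq_abs, abs_le]
  constructor <;> linarith

theorem exp_neg_sub_exp_neg_le (a b : ℝ) :
    Real.exp (-b) - Real.exp (-a) ≤ Real.exp (-b) * (a - b) := by
  have h := Real.add_one_le_exp (b - a)
  have hs : Real.exp (-a) = Real.exp (-b) * Real.exp (b - a) := by
    rw [← Real.exp_add]; congr 1; ring
  rw [hs]
  nlinarith [Real.exp_pos (-b)]

theorem reflectedNormal_risk_sub_le (p : ℕ) {σ12 σ22 γ : ℝ} (hσ1 : 0 < σ12) (hσ2 : 0 < σ22)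
    (hγ : 0 < γ) {f : Ep p × Ep p → Ep p} (hf : Measurable f) (θ1 θ2 : Ep p)
    (hint : Integrable (fun z : Ep p × Ep p =>
      ‖f z - θ1‖ ^ 2 * jointDens p (γ * σ12 / (γ + σ12)) σ22 θ1 θ2 z)) :
    (∫ x : Ep p × Ep p, (1 - Real.exp (-‖f x - θ1‖ ^ 2 / (2 * γ))) *
        jointDens p σ12 σ22 θ1 θ2 x) -
      (∫ x : Ep p × Ep p, (1 - Real.exp (-‖x.1 - θ1‖ ^ 2 / (2 * γ))) *
        jointDens p σ12 σ22 θ1 θ2 x) ≤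
      (1 / (2 * γ)) * (γ / (γ + σ12)) ^ ((p : ℝ) / 2) *
        ((∫ z : Ep p × Ep p, ‖f z - θ1‖ ^ 2 *
            jointDens p (γ * σ12 / (γ + σ12)) σ22 θ1 θ2 z) -
          (∫ z : Ep p × Ep p, ‖z.1 - θ1‖ ^ 2 *
            jointDens p (γ * σ12 / (γ + σ12)) σ22 θ1 θ2 z)) := by
  have hZ : 0 < γ * σ12 / (γ + σ12) := by positivity
  have hi1 := integrable_reflectedNormalLoss p hσ1 hσ2 hγ θ1 θ2 hf
  have hi2 := integrable_reflectedNormalLoss p hσ1 hσ2 hγ θ1 θ2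
    (measurable_fst : Measurable (Prod.fst : Ep p × Ep p → Ep p))
  have hi4 := integrable_norm_sq_mul_jointDens p hZ hσ2 θ1 θ2
  rw [← integral_sub hi1 hi2, ← integral_sub hint hi4, ← integral_const_mul]
  refine integral_mono (hi1.sub hi2) ((hint.sub hi4).const_mul _) fun x => ?_
  have htilt : Real.exp (-‖x.1 - θ1‖ ^ 2 / (2 * γ)) * jointDens p σ12 σ22 θ1 θ2 x =
      (γ / (γ + σ12)) ^ ((p : ℝ) / 2) * jointDens p (γ * σ12 / (γ + σ12)) σ22 θ1 θ2 x := by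
    simp only [jointDens]
    rw [← mul_assoc, exp_mul_gdens p hσ1 hγ, mul_assoc]
  have hconc := mul_le_mul_of_nonneg_right
    (exp_neg_sub_exp_neg_le (‖f x - θ1‖ ^ 2 / (2 * γ)) (‖x.1 - θ1‖ ^ 2 / (2 * γ)))
    (jointDens_nonneg p hσ1 hσ2 θ1 θ2 x)
  simp only [← neg_div] at hconc
  calc _ = _ := by ring
    _ ≤ _ := hconc
    _ = (‖f x - θ1‖ ^ 2 / (2 * γ) - ‖x.1 - θ1‖ ^ 2 / (2 * γ)) *
        (Real.exp (-‖x.1 - θ1‖ ^ 2 / (2 * γ)) * jointDens p σ12 σ22 θ1 θ2 x) := by ring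
    _ = _ := by rw [htilt]; ring

/-- Concave-inequality bound: the reflected-normal risk difference of `θ̂1(X)` versus `X1`
is bounded by a positive multiple of the squared-error risk difference of `θ̂1(Z)` versus
`Z1` in the model with shrunken variance `σ_{Z1}² = γσ1²/(γ+σ1²)`; in particular
squared-error dominance in the `Z`-model implies reflected-normal dominance in the
`X`-model over the restricted parameter space. -/
theorem stmt8 (p : ℕ) (σ12 σ22 : ℝ) (hσ1 : 0 < σ12) (hσ2 : 0 < σ22)
    (γ : ℝ) (hγ : 0 < γ) (σZ12 : ℝ) (hσZ : σZ12 = γ * σ12 / (γ + σ12))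
    (θhat : Ep p × Ep p → Ep p) (hmeas : Measurable θhat)
    (A : Set (Ep p)) :
    (∀ θ1 θ2 : Ep p,
      Integrable (fun z : Ep p × Ep p =>
        ‖θhat z - θ1‖ ^ 2 * jointDens p σZ12 σ22 θ1 θ2 z) →
      (∫ x : Ep p × Ep p, (1 - Real.exp (-‖θhat x - θ1‖ ^ 2 / (2 * γ))) *
          jointDens p σ12 σ22 θ1 θ2 x) -
      (∫ x : Ep p × Ep p, (1 - Real.exp (-‖x.1 - θ1‖ ^ 2 / (2 * γ))) *
          jointDens p σ12 σ22 θ1 θ2 x) ≤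
      (1 / (2 * γ)) * (γ / (γ + σ12)) ^ ((p : ℝ) / 2) *
        ((∫ z : Ep p × Ep p, ‖θhat z - θ1‖ ^ 2 * jointDens p σZ12 σ22 θ1 θ2 z) -
         (∫ z : Ep p × Ep p, ‖z.1 - θ1‖ ^ 2 * jointDens p σZ12 σ22 θ1 θ2 z))) ∧
    ((∀ θ1 θ2 : Ep p, θ1 - θ2 ∈ A →
        Integrable (fun z : Ep p × Ep p =>
          ‖θhat z - θ1‖ ^ 2 * jointDens p σZ12 σ22 θ1 θ2 z)) →
     (∀ θ1 θ2 : Ep p, θ1 - θ2 ∈ A →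
        (∫ z : Ep p × Ep p, ‖θhat z - θ1‖ ^ 2 * jointDens p σZ12 σ22 θ1 θ2 z) ≤
        (∫ z : Ep p × Ep p, ‖z.1 - θ1‖ ^ 2 * jointDens p σZ12 σ22 θ1 θ2 z)) →
     (∃ θ1 θ2 : Ep p, θ1 - θ2 ∈ A ∧
        (∫ z : Ep p × Ep p, ‖θhat z - θ1‖ ^ 2 * jointDens p σZ12 σ22 θ1 θ2 z) <
        (∫ z : Ep p × Ep p, ‖z.1 - θ1‖ ^ 2 * jointDens p σZ12 σ22 θ1 θ2 z)) →
     ((∀ θ1 θ2 : Ep p, θ1 - θ2 ∈ A →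
        (∫ x : Ep p × Ep p, (1 - Real.exp (-‖θhat x - θ1‖ ^ 2 / (2 * γ))) *
            jointDens p σ12 σ22 θ1 θ2 x) ≤
        (∫ x : Ep p × Ep p, (1 - Real.exp (-‖x.1 - θ1‖ ^ 2 / (2 * γ))) *
            jointDens p σ12 σ22 θ1 θ2 x)) ∧
      (∃ θ1 θ2 : Ep p, θ1 - θ2 ∈ A ∧
        (∫ x : Ep p × Ep p, (1 - Real.exp (-‖θhat x - θ1‖ ^ 2 / (2 * γ))) *
            jointDens p σ12 σ22 θ1 θ2 x) <
        (∫ x : Ep p × Ep p, (1 - Real.exp (-‖x.1 - θ1‖ ^ 2 / (2 * γ))) *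
            jointDens p σ12 σ22 θ1 θ2 x)))) := by
  subst hσZ
  have hbound := fun θ1 θ2 => reflectedNormal_risk_sub_le p hσ1 hσ2 hγ hmeas θ1 θ2
  have hc : 0 < (1 / (2 * γ)) * (γ / (γ + σ12)) ^ ((p : ℝ) / 2) := by positivity
  refine ⟨hbound, fun hint hle ⟨θ1, θ2, hA, hlt⟩ => ⟨fun η1 η2 hη => ?_, θ1, θ2, hA, ?_⟩⟩
  · exact sub_nonpos.1 ((hbound η1 η2 (hint η1 η2 hη)).trans
      (mul_nonpos_of_nonneg_of_nonpos hc.le (sub_nonpos.2 (hle η1 η2 hη))))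
  · exact sub_neg.1 ((hbound θ1 θ2 (hint θ1 θ2 hA)).trans_lt
      (mul_neg_of_pos_of_neg hc (sub_neg.2 hlt)))

end
end

section
/- Let p = 1 and A = [0, ∞). Suppose the predictive densities q̂_mre and q̂_B are constructed with the nominal variances σ1², σ2², σ_Y² as follows: τ = √(σ1² + σ_Y²), β = σ1²/(σ1² + σ_Y²), σ_T² = σ2² + βσ_Y², q̂_mre(y;x) = (1/τ)φ((y − x1)/τ), q̂_B(y;x) = (1/τ)φ((y − x1)/τ)·Φ((β(y − x1) + (x1 − x2))/σ_T)/Φ((x1 − x2)/√(σ1² + σ2²)), but the true distributions are X1 ~ N(θ1, a1²σ1²), X2 ~ N(θ2, a2²σ2²), Y1 ~ N(θ1, a_Y²σ_Y²) independent, with a1, a2, a_Y > 0, and the Kullback–Leibler risk is computed under these true distributions. Define σ_U² = ( a2²σ2² + (1 − β)² a1²σ1² + β² a_Y²σ_Y² ) / ( σ2² + βσ_Y² ) and σ_V² = ( a1²σ1² + a2²σ2² ) / ( σ1² + σ2² ). If σ_U² ≤ σ_V², then R_KL(θ, q̂_B) ≤ R_KL(θ, q̂_mre) for every (θ1, θ2)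 with θ1 ≥ θ2. In particular this holds in each of the cases: (i) a1² = a2² = a_Y²; (ii) a_Y² ≤ a1² = a2²; (iii) σ1² = σ2² = σ_Y² and (a2² + a_Y²)/2 ≤ a1². -/
open MeasureTheory Real Set

noncomputable section

/-- Standard normal probability density function. -/
def stdPdf (z : ℝ) : ℝ := (Real.sqrt (2 * Real.pi))⁻¹ * Real.exp (-z ^ 2 / 2)

/-- Standard normal cumulative distribution function. -/
def stdCdf (x : ℝ) : ℝ := ∫ t in Set.Iic x, stdPdf t

/-- Density of `N(θ, σ²)` (σ the standard deviation) at `y`. -/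
def gd (σ : ℝ) (u : ℝ) : ℝ := σ⁻¹ * stdPdf (u / σ)

/-- Kullback–Leibler risk in the univariate model with (true) standard deviations
`s1, s2, sY` for `X1, X2, Y1`. -/
def klRisk1 (s1 s2 sY : ℝ) (θ1 θ2 : ℝ) (qhat : ℝ × ℝ → ℝ → ℝ) : ℝ :=
  ∫ x : ℝ × ℝ,
    (∫ y : ℝ, gd sY (y - θ1) * Real.log (gd sY (y - θ1) / qhat x y)) *
      (gd s1 (x.1 - θ1) * gd s2 (x.2 - θ2))

/-- Dominance of the (nominal-variance) Bayes predictive density over the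
(nominal-variance) MRE predictive density for `θ1 ≥ θ2`, under the true model. -/
def dominates (σ1 σ2 σY a1 a2 aY τ β σT : ℝ) : Prop :=
  ∀ θ1 θ2 : ℝ, θ2 ≤ θ1 →
    klRisk1 (a1 * σ1) (a2 * σ2) (aY * σY) θ1 θ2
        (fun x y => τ⁻¹ * stdPdf ((y - x.1) / τ) *
          stdCdf ((β * (y - x.1) + (x.1 - x.2)) / σT) /
          stdCdf ((x.1 - x.2) / Real.sqrt (σ1 ^ 2 + σ2 ^ 2))) ≤
      klRisk1 (a1 * σ1) (a2 * σ2) (aY * σY) θ1 θ2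
        (fun x y => τ⁻¹ * stdPdf ((y - x.1) / τ))

open ProbabilityTheory
open scoped NNReal

section StdNormal

lemma stdPdf_eq_gaussianPDFReal : stdPdf = gaussianPDFReal 0 1 := by
  ext x
  simp [stdPdf, gaussianPDFReal]

lemma stdPdf_pos (x : ℝ) : 0 < stdPdf x := by
  unfold stdPdf
  positivity

lemma continuous_stdPdf : Continuous stdPdf := by
  unfold stdPdf
  fun_prop

lemma integrable_stdPdf : Integrable stdPdf :=
  stdPdf_eq_gaussianPDFReal ▸ integrable_gaussianPDFReal 0 1

lemma integral_stdPdf : ∫ x, stdPdf x = 1 :=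
  stdPdf_eq_gaussianPDFReal ▸ integral_gaussianPDFReal_eq_one 0 one_ne_zero

lemma hasDerivAt_stdPdf (x : ℝ) : HasDerivAt stdPdf (-(x * stdPdf x)) x := by
  unfold stdPdf
  have h : HasDerivAt (fun z : ℝ => -z ^ 2 / 2) (-x) x := by
    convert! (((hasDerivAt_id x).pow 2).neg.div_const 2) using 1
    simp
    ring
  convert! (h.exp.const_mul ((√(2 * π))⁻¹)) using 1
  ring

lemma integrable_mul_stdPdf : Integrable fun x => x * stdPdf x := by
  refine ((integrable_mul_exp_neg_mul_sq (b := 1 / 2) (by norm_num)).const_mul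
    ((√(2 * π))⁻¹)).congr (.of_forall fun x => ?_)
  simp only [stdPdf]
  ring_nf

lemma setIntegral_Iic_mul_stdPdf (x : ℝ) : ∫ t in Iic x, t * stdPdf t = -stdPdf x := by
  have hd (t : ℝ) : HasDerivAt (fun t => -stdPdf t) (t * stdPdf t) t := by
    convert! (hasDerivAt_stdPdf t).neg using 1
    rw [neg_neg]
  have h := integral_Iic_of_hasDerivAt_of_tendsto' (a := x) (fun t _ => hd t)
    integrable_mul_stdPdf.integrableOn (tendsto_zero_of_hasDerivAt_of_integrableOn_Iic (a := x)
      (fun t _ => hd t) integrable_mul_stdPdf.integrableOn integrable_stdPdf.neg.integrableOn)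
  simpa using h

lemma hasDerivAt_stdCdf (x : ℝ) : HasDerivAt stdCdf (stdPdf x) x := by
  have h : stdCdf = fun y => stdCdf 0 + ∫ t in (0 : ℝ)..y, stdPdf t := by
    ext y
    rw [← intervalIntegral.integral_Iic_sub_Iic integrable_stdPdf.integrableOn
      integrable_stdPdf.integrableOn]
    simp [stdCdf]
  rw [h]
  exact (continuous_stdPdf.integral_hasStrictDerivAt 0 x).hasDerivAt.const_add _

lemma stdCdf_pos (x : ℝ) : 0 < stdCdf x := by
  rw [stdCdf, setIntegral_pos_iff_support_of_nonneg_ae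
    (.of_forall fun t => (stdPdf_pos t).le) integrable_stdPdf.integrableOn]
  have : Function.support stdPdf = univ := by
    ext t
    simp [(stdPdf_pos t).ne']
  simp [this]

lemma stdCdf_le_one (x : ℝ) : stdCdf x ≤ 1 :=
  integral_stdPdf ▸ setIntegral_le_integral integrable_stdPdf
    (.of_forall fun t => (stdPdf_pos t).le)

lemma monotone_stdCdf : Monotone stdCdf :=
  monotone_of_hasDerivAt_nonneg hasDerivAt_stdCdf fun x => (stdPdf_pos x).le

lemma stdPdf_add_mul_stdCdf_nonneg (x : ℝ) : 0 ≤ stdPdf x + x * stdCdf x := by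
  have h : stdPdf x + x * stdCdf x = ∫ t in Iic x, (x - t) * stdPdf t := by
    simp_rw [sub_mul]
    rw [integral_sub (integrable_stdPdf.const_mul x).integrableOn
      integrable_mul_stdPdf.integrableOn, integral_const_mul, setIntegral_Iic_mul_stdPdf, stdCdf]
    ring
  rw [h]
  exact setIntegral_nonneg measurableSet_Iic fun t ht =>
    mul_nonneg (sub_nonneg.2 ht) (stdPdf_pos t).le

lemma hasDerivAt_log_stdCdf (x : ℝ) :
    HasDerivAt (fun x => log (stdCdf x)) (stdPdf x / stdCdf x) x :=
  (hasDerivAt_stdCdf x).log (stdCdf_pos x).ne'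

lemma continuous_log_stdCdf : Continuous fun x => log (stdCdf x) :=
  continuous_iff_continuousAt.2 fun x => (hasDerivAt_log_stdCdf x).continuousAt

lemma monotone_log_stdCdf : Monotone fun x => log (stdCdf x) :=
  fun x _ h => log_le_log (stdCdf_pos x) (monotone_stdCdf h)

lemma concaveOn_log_stdCdf : ConcaveOn ℝ univ fun x => log (stdCdf x) := by
  refine Antitone.concaveOn_univ_of_deriv
    (fun x => (hasDerivAt_log_stdCdf x).differentiableAt) ?_
  rw [funext fun x => (hasDerivAt_log_stdCdf x).deriv]
  refine antitone_of_hasDerivAt_nonpos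
    (fun x => (hasDerivAt_stdPdf x).div (hasDerivAt_stdCdf x) (stdCdf_pos x).ne') fun x => ?_
  refine div_nonpos_of_nonpos_of_nonneg ?_ (sq_nonneg _)
  nlinarith [mul_nonneg (stdPdf_pos x).le (stdPdf_add_mul_stdCdf_nonneg x)]

lemma stdPdf_neg_abs_sub_one_le_stdCdf (x : ℝ) : stdPdf (|x| + 1) ≤ stdCdf x := by
  calc stdPdf (|x| + 1) = ∫ _ in Ioc (x - 1) x, stdPdf (|x| + 1) := by simp
    _ ≤ ∫ t in Ioc (x - 1) x, stdPdf t := by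
        refine setIntegral_mono_on (by simp) integrable_stdPdf.integrableOn measurableSet_Ioc
          fun t ht => ?_
        unfold stdPdf
        gcongr 2
        have h : |t| ≤ |x| + 1 := abs_le.2
          ⟨by linarith [ht.1, neg_abs_le x], by linarith [ht.2, le_abs_self x]⟩
        have := sq_le_sq.2 (h.trans (le_abs_self _))
        linarith
    _ ≤ stdCdf x := setIntegral_mono_set integrable_stdPdf.integrableOn
        (.of_forall fun t => (stdPdf_pos t).le) (.of_forall fun t ht => ht.2)

lemma abs_log_stdCdf_le (x : ℝ) :
    |log (stdCdf x)| ≤ x ^ 2 + (1 + log (√(2 * π))) := by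
  have h := log_le_log (stdPdf_pos _) (stdPdf_neg_abs_sub_one_le_stdCdf x)
  rw [stdPdf, log_mul (by positivity) (by positivity), log_exp, log_inv] at h
  rw [abs_of_nonpos (log_nonpos (stdCdf_pos x).le (stdCdf_le_one x))]
  nlinarith [sq_nonneg (|x| - 1), sq_abs x]

lemma integrable_log_stdCdf_gaussianReal (m : ℝ) (v : ℝ≥0) :
    Integrable (fun x => log (stdCdf x)) (gaussianReal m v) := by
  refine Integrable.mono' (g := fun x => x ^ 2 + (1 + log (√(2 * π)))) ?_
    continuous_log_stdCdf.aestronglyMeasurable (.of_forall fun x => abs_log_stdCdf_le x)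
  exact (memLp_id_gaussianReal 2).integrable_sq.add (integrable_const _)

end StdNormal

section Comparison

lemma gaussianReal_eq_map_standard (m s : ℝ) :
    gaussianReal m (s ^ 2).toNNReal = (gaussianReal 0 1).map fun z => m + s * z := by
  rw [show (fun z => m + s * z) = (m + ·) ∘ (s * ·) from rfl,
    ← Measure.map_map (by fun_prop) (by fun_prop), gaussianReal_map_const_mul,
    gaussianReal_map_const_add]
  simp only [mul_zero, zero_add, mul_one]
  congr 1
  exact Real.toNNReal_of_nonneg _

lemma ConcaveOn.add_symm_le {f : ℝ → ℝ} (hf : ConcaveOn ℝ univ f) {s t : ℝ} (hs : 0 ≤ s)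
    (hst : s ≤ t) (m z : ℝ) : f (m + t * z) + f (m + -t * z) ≤ f (m + s * z) + f (m + -s * z) := by
  obtain rfl | ht := (hs.trans hst).eq_or_lt
  · obtain rfl : s = 0 := le_antisymm hst hs
    simp
  have ha : 0 ≤ (1 + s / t) / 2 := by positivity
  have hb : 0 ≤ (1 - s / t) / 2 := by
    have := (div_le_one ht).2 hst
    linarith
  have h₁ := hf.2 (mem_univ (m + t * z)) (mem_univ (m + -t * z)) ha hb (by ring)
  have h₂ := hf.2 (mem_univ (m + t * z)) (mem_univ (m + -t * z)) hb ha (by ring)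
  simp only [smul_eq_mul] at h₁ h₂
  rw [show (1 + s / t) / 2 * (m + t * z) + (1 - s / t) / 2 * (m + -t * z) = m + s * z by
    field_simp; ring] at h₁
  rw [show (1 - s / t) / 2 * (m + t * z) + (1 + s / t) / 2 * (m + -t * z) = m + -s * z by
    field_simp; ring] at h₂
  linarith

/-- Gaussian expectations of an increasing concave function increase with the mean and decrease
with the variance. -/
lemma integral_gaussianReal_le_of_concaveOn {f : ℝ → ℝ} (hc : ConcaveOn ℝ univ f)
    (hm : Monotone f) (hf : Continuous f) (hi : ∀ m v, Integrable f (gaussianReal m v))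
    {m n : ℝ} {v w : ℝ≥0} (hmn : m ≤ n) (hwv : w ≤ v) :
    ∫ x, f x ∂gaussianReal m v ≤ ∫ x, f x ∂gaussianReal n w := by
  have hint (m s : ℝ) : Integrable (fun z => f (m + s * z)) (gaussianReal 0 1) :=
    (integrable_map_measure hf.aestronglyMeasurable (by fun_prop)).1
      (gaussianReal_eq_map_standard m s ▸ hi m _)
  have key (m s : ℝ) : ∫ x, f x ∂gaussianReal m (s ^ 2).toNNReal =
      ∫ z, f (m + s * z) ∂gaussianReal 0 1 := by
    rw [gaussianReal_eq_map_standard, integral_map (by fun_prop) hf.aestronglyMeasurable]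
  have key₂ (m : ℝ) (v : ℝ≥0) : 2 * ∫ x, f x ∂gaussianReal m v =
      ∫ z, (f (m + √v * z) + f (m + -√v * z)) ∂gaussianReal 0 1 := by
    rw [integral_add (hint _ _) (hint _ _), ← key, ← key]
    simp [two_mul]
  suffices 2 * ∫ x, f x ∂gaussianReal m v ≤ 2 * ∫ x, f x ∂gaussianReal n w by linarith
  rw [key₂, key₂]
  refine integral_mono ((hint _ _).add (hint _ _)) ((hint _ _).add (hint _ _)) fun z => ?_
  calc f (m + √v * z) + f (m + -√v * z) ≤ f (m + √w * z) + f (m + -√w * z) :=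
        hc.add_symm_le (sqrt_nonneg _) (sqrt_le_sqrt (by exact_mod_cast hwv)) m z
    _ ≤ f (n + √w * z) + f (n + -√w * z) := by gcongr <;> exact hm (by gcongr)

lemma map_linear_gaussianReal_prod (m₁ m₂ m₃ : ℝ) (v₁ v₂ v₃ : ℝ≥0) (a b c : ℝ) :
    (((gaussianReal m₁ v₁).prod (gaussianReal m₂ v₂)).prod (gaussianReal m₃ v₃)).map
      (fun p => a * p.1.1 + b * p.1.2 + c * p.2) =
    gaussianReal (a * m₁ + b * m₂ + c * m₃) (a ^ 2 * v₁ + b ^ 2 * v₂ + c ^ 2 * v₃).toNNReal := by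
  have hadd {m₁ m₂ : ℝ} {v₁ v₂ : ℝ≥0} :
      ((gaussianReal m₁ v₁).prod (gaussianReal m₂ v₂)).map (fun q => q.1 + q.2) =
        gaussianReal (m₁ + m₂) (v₁ + v₂) := gaussianReal_conv_gaussianReal
  have hcomp : (fun p : (ℝ × ℝ) × ℝ => a * p.1.1 + b * p.1.2 + c * p.2) =
      (fun q : ℝ × ℝ => q.1 + q.2) ∘
        Prod.map ((fun q : ℝ × ℝ => q.1 + q.2) ∘ Prod.map (a * ·) (b * ·)) (c * ·) := rfl
  rw [hcomp, ← Measure.map_map (by fun_prop) (by fun_prop),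
    ← Measure.map_prod_map _ _ (by fun_prop) (by fun_prop),
    ← Measure.map_map (by fun_prop) (by fun_prop),
    ← Measure.map_prod_map _ _ (by fun_prop) (by fun_prop)]
  simp only [gaussianReal_map_const_mul, hadd]
  congr 1
  ext
  rw [Real.coe_toNNReal _ (by positivity)]
  simp

end Comparison

section Risk

lemma gd_sub_eq_gaussianPDFReal {s : ℝ} (hs : 0 < s) (θ u : ℝ) :
    gd s (u - θ) = gaussianPDFReal θ (s ^ 2).toNNReal u := by
  rw [gd, stdPdf, gaussianPDFReal, Real.coe_toNNReal _ (by positivity), sqrt_mul (by positivity) (s ^ 2),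
    sqrt_sq hs.le]
  have : -((u - θ) / s) ^ 2 / 2 = -(u - θ) ^ 2 / (2 * s ^ 2) := by field_simp
  rw [this]
  ring

lemma klRisk1_eq_integral {s1 s2 sY : ℝ} (h1 : 0 < s1) (h2 : 0 < s2) (hY : 0 < sY) (θ1 θ2 : ℝ)
    (q : ℝ × ℝ → ℝ → ℝ) :
    klRisk1 s1 s2 sY θ1 θ2 q =
      ∫ x, ∫ y, log (gd sY (y - θ1) / q x y) ∂gaussianReal θ1 (sY ^ 2).toNNReal
        ∂(gaussianReal θ1 (s1 ^ 2).toNNReal).prod (gaussianReal θ2 (s2 ^ 2).toNNReal) := by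
  have hv {s : ℝ} (hs : 0 < s) : (s ^ 2).toNNReal ≠ 0 :=
    (Real.toNNReal_pos.2 (by positivity)).ne'
  rw [gaussianReal_of_var_ne_zero θ1 (hv h1), gaussianReal_of_var_ne_zero θ2 (hv h2),
    prod_withDensity (by fun_prop) (by fun_prop), ← Measure.volume_eq_prod,
    integral_withDensity_eq_integral_toReal_smul (by fun_prop)
      (.of_forall fun x => ENNReal.mul_lt_top gaussianPDF_lt_top gaussianPDF_lt_top)]
  simp_rw [klRisk1, integral_gaussianReal_eq_integral_smul (hv hY), gd_sub_eq_gaussianPDFReal h1,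
    gd_sub_eq_gaussianPDFReal h2, gd_sub_eq_gaussianPDFReal hY, ENNReal.toReal_mul,
    toReal_gaussianPDF, smul_eq_mul, mul_comm]

lemma log_gd {s : ℝ} (hs : 0 < s) (u : ℝ) :
    log (gd s u) = -u ^ 2 / (2 * s ^ 2) - log (s * √(2 * π)) := by
  rw [gd, stdPdf, log_mul (by positivity) (by positivity), log_mul (by positivity) (by positivity),
    log_exp, log_inv, log_inv, log_mul (by positivity) (by positivity)]
  field_simp
  ring

lemma gd_pos {s : ℝ} (hs : 0 < s) (u : ℝ) : 0 < gd s u :=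
  mul_pos (inv_pos.2 hs) (stdPdf_pos _)

/-- Multiplying a predictive density `q` by `Φ(U) / Φ(V)`, with `U` and `V` linear, does not
increase the Kullback–Leibler risk when `U` has larger mean and smaller variance than `V`. -/
lemma klRisk1_le_of_mean_le_of_variance_le {s1 s2 sY τ : ℝ} (h1 : 0 < s1) (h2 : 0 < s2)
    (hY : 0 < sY) (hτ : 0 < τ) {θ1 θ2 : ℝ} {a b c d e : ℝ}
    (hmean : d * θ1 + e * θ2 ≤ a * θ1 + b * θ2 + c * θ1)
    (hvar : a ^ 2 * s1 ^ 2 + b ^ 2 * s2 ^ 2 + c ^ 2 * sY ^ 2 ≤ d ^ 2 * s1 ^ 2 + e ^ 2 * s2 ^ 2) :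
    klRisk1 s1 s2 sY θ1 θ2 (fun x y => gd τ (y - x.1) * stdCdf (a * x.1 + b * x.2 + c * y) /
        stdCdf (d * x.1 + e * x.2)) ≤
      klRisk1 s1 s2 sY θ1 θ2 (fun x y => gd τ (y - x.1)) := by
  rw [klRisk1_eq_integral h1 h2 hY, klRisk1_eq_integral h1 h2 hY]
  set P := (gaussianReal θ1 (s1 ^ 2).toNNReal).prod (gaussianReal θ2 (s2 ^ 2).toNNReal)
  set Q := gaussianReal θ1 (sY ^ 2).toNNReal
  have hlaw (a b c : ℝ) : (P.prod Q).map (fun p => a * p.1.1 + b * p.1.2 + c * p.2) =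
      gaussianReal (a * θ1 + b * θ2 + c * θ1)
        (a ^ 2 * s1 ^ 2 + b ^ 2 * s2 ^ 2 + c ^ 2 * sY ^ 2).toNNReal := by
    rw [map_linear_gaussianReal_prod]
    simp [sq_nonneg]
  have hint {f : ℝ → ℝ} (hf : Continuous f) (hi : ∀ m v, Integrable f (gaussianReal m v))
      (a b c : ℝ) : Integrable (fun p => f (a * p.1.1 + b * p.1.2 + c * p.2)) (P.prod Q) :=
    (integrable_map_measure hf.aestronglyMeasurable (by fun_prop)).1 (hlaw a b c ▸ hi _ _)
  have hΦ (a b c : ℝ) :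
      Integrable (fun p => log (stdCdf (a * p.1.1 + b * p.1.2 + c * p.2))) (P.prod Q) :=
    hint continuous_log_stdCdf integrable_log_stdCdf_gaussianReal a b c
  have hgd {s : ℝ} (hs : 0 < s) (θ : ℝ) (a c : ℝ) :
      Integrable (fun p => log (gd s (a * p.1.1 + 0 * p.1.2 + c * p.2 - θ))) (P.prod Q) := by
    refine hint (f := fun x => log (gd s (x - θ))) ?_ (fun m v => ?_) a 0 c
    · simp_rw [log_gd hs]
      fun_prop
    · simp_rw [log_gd hs]
      exact ((((memLp_id_gaussianReal 2).sub (memLp_const θ)).integrable_sq.neg).div_const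
        _).sub (integrable_const _)
  have hL : Integrable (fun p => log (gd sY (p.2 - θ1) / gd τ (p.2 - p.1.1))) (P.prod Q) := by
    refine ((hgd hY θ1 0 1).sub (hgd hτ 0 (-1) 1)).congr (.of_forall fun p => ?_)
    simp only [Pi.sub_apply]
    rw [log_div (gd_pos hY _).ne' (gd_pos hτ _).ne']
    ring_nf
  have hsplit (p : (ℝ × ℝ) × ℝ) : log (gd sY (p.2 - θ1) / (gd τ (p.2 - p.1.1) *
      stdCdf (a * p.1.1 + b * p.1.2 + c * p.2) / stdCdf (d * p.1.1 + e * p.1.2))) =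
      log (gd sY (p.2 - θ1) / gd τ (p.2 - p.1.1)) -
        (log (stdCdf (a * p.1.1 + b * p.1.2 + c * p.2)) -
          log (stdCdf (d * p.1.1 + e * p.1.2 + 0 * p.2))) := by
    have hg := (gd_pos hτ (p.2 - p.1.1)).ne'
    rw [log_div (gd_pos hY _).ne' (div_ne_zero (mul_ne_zero hg (stdCdf_pos _).ne')
      (stdCdf_pos _).ne'), log_div (mul_ne_zero hg (stdCdf_pos _).ne') (stdCdf_pos _).ne',
      log_mul hg (stdCdf_pos _).ne', log_div (gd_pos hY _).ne' hg, zero_mul, add_zero]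
    ring
  have hD : Integrable (fun p => log (stdCdf (a * p.1.1 + b * p.1.2 + c * p.2)) -
      log (stdCdf (d * p.1.1 + e * p.1.2 + 0 * p.2))) (P.prod Q) := (hΦ a b c).sub (hΦ d e 0)
  have hΦint (a b c : ℝ) : ∫ p, log (stdCdf (a * p.1.1 + b * p.1.2 + c * p.2)) ∂P.prod Q =
      ∫ u, log (stdCdf u) ∂gaussianReal (a * θ1 + b * θ2 + c * θ1)
        (a ^ 2 * s1 ^ 2 + b ^ 2 * s2 ^ 2 + c ^ 2 * sY ^ 2).toNNReal := by
    rw [← hlaw, integral_map (by fun_prop) continuous_log_stdCdf.aestronglyMeasurable]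
  rw [← integral_prod (fun p : (ℝ × ℝ) × ℝ => log (gd sY (p.2 - θ1) / gd τ (p.2 - p.1.1))) hL,
    ← integral_prod (fun p : (ℝ × ℝ) × ℝ => log (gd sY (p.2 - θ1) / (gd τ (p.2 - p.1.1) *
      stdCdf (a * p.1.1 + b * p.1.2 + c * p.2) / stdCdf (d * p.1.1 + e * p.1.2))))
      ((hL.sub hD).congr (.of_forall fun p => (hsplit p).symm))]
  simp_rw [hsplit]
  rw [integral_sub hL hD, integral_sub (hΦ a b c) (hΦ d e 0), hΦint, hΦint, sub_le_self_iff,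
    sub_nonneg]
  exact integral_gaussianReal_le_of_concaveOn concaveOn_log_stdCdf monotone_log_stdCdf
    continuous_log_stdCdf integrable_log_stdCdf_gaussianReal (by linarith)
    (Real.toNNReal_le_toNNReal (by linarith))

end Risk

/-- Robustness of the Kullback–Leibler dominance of the Bayes predictive density over
the MRE one (case `p = 1`, `A = [0, ∞)`) when the variances are misspecified:
dominance persists whenever `σ_U² ≤ σ_V²`, in particular in cases (i), (ii), (iii). -/
theorem stmt18 (σ1 σ2 σY a1 a2 aY : ℝ)
    (h1 : 0 < σ1) (h2 : 0 < σ2) (hY : 0 < σY)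
    (ha1 : 0 < a1) (ha2 : 0 < a2) (haY : 0 < aY)
    (τ β σT : ℝ) (hτ : τ = Real.sqrt (σ1 ^ 2 + σY ^ 2))
    (hβ : β = σ1 ^ 2 / (σ1 ^ 2 + σY ^ 2))
    (hσT : σT = Real.sqrt (σ2 ^ 2 + β * σY ^ 2))
    (σU2 σV2 : ℝ)
    (hσU2 : σU2 = (a2 ^ 2 * σ2 ^ 2 + (1 - β) ^ 2 * a1 ^ 2 * σ1 ^ 2 +
      β ^ 2 * aY ^ 2 * σY ^ 2) / (σ2 ^ 2 + β * σY ^ 2))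
    (hσV2 : σV2 = (a1 ^ 2 * σ1 ^ 2 + a2 ^ 2 * σ2 ^ 2) / (σ1 ^ 2 + σ2 ^ 2)) :
    (σU2 ≤ σV2 → dominates σ1 σ2 σY a1 a2 aY τ β σT) ∧
    (a1 ^ 2 = a2 ^ 2 ∧ a2 ^ 2 = aY ^ 2 → dominates σ1 σ2 σY a1 a2 aY τ β σT) ∧
    (aY ^ 2 ≤ a1 ^ 2 ∧ a1 ^ 2 = a2 ^ 2 → dominates σ1 σ2 σY a1 a2 aY τ β σT) ∧
    (σ1 ^ 2 = σ2 ^ 2 ∧ σ2 ^ 2 = σY ^ 2 ∧ (a2 ^ 2 + aY ^ 2) / 2 ≤ a1 ^ 2 →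
      dominates σ1 σ2 σY a1 a2 aY τ β σT) := by
  have hDpos : 0 < σ2 ^ 2 + β * σY ^ 2 := by rw [hβ]; positivity
  have hs : 0 < σ1 ^ 2 + σY ^ 2 := by positivity
  have hmain (h : σU2 ≤ σV2) : dominates σ1 σ2 σY a1 a2 aY τ β σT := by
    intro θ1 θ2 hθ
    set ρ := √(σ1 ^ 2 + σ2 ^ 2) with hρ
    have hρpos : 0 < ρ := by positivity
    have hσTpos : 0 < σT := hσT ▸ sqrt_pos.2 hDpos
    have hτpos : 0 < τ := hτ ▸ sqrt_pos.2 hs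
    have hρsq : ρ ^ 2 = σ1 ^ 2 + σ2 ^ 2 := sq_sqrt (by positivity)
    have hσTsq : σT ^ 2 = σ2 ^ 2 + β * σY ^ 2 := hσT ▸ sq_sqrt hDpos.le
    have hβσ : β * σY ^ 2 ≤ σ1 ^ 2 := by
      rw [hβ, div_mul_eq_mul_div, div_le_iff₀ hs]
      nlinarith [sq_nonneg (σ1 ^ 2)]
    have hσTρ : σT ≤ ρ := by
      rw [hσT]
      exact sqrt_le_sqrt (by linarith)
    have hU (x : ℝ × ℝ) (y : ℝ) : (β * (y - x.1) + (x.1 - x.2)) / σT =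
        (1 - β) / σT * x.1 + -1 / σT * x.2 + β / σT * y := by ring
    have hV (x : ℝ × ℝ) : (x.1 - x.2) / ρ = 1 / ρ * x.1 + -1 / ρ * x.2 := by ring
    simp_rw [hU, hV]
    refine klRisk1_le_of_mean_le_of_variance_le (mul_pos ha1 h1) (mul_pos ha2 h2) (mul_pos haY hY)
      hτpos ?_ ?_
    · have h := div_le_div_of_nonneg_left (sub_nonneg.2 hθ) hσTpos hσTρ
      calc 1 / ρ * θ1 + -1 / ρ * θ2 = (θ1 - θ2) / ρ := by ring
        _ ≤ (θ1 - θ2) / σT := h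
        _ = _ := by ring
    · rw [hσU2, hσV2, ← hσTsq, ← hρsq] at h
      convert! h using 1 <;> ring
  have hbayes (h : aY ^ 2 ≤ a1 ^ 2) (h' : a1 ^ 2 = a2 ^ 2) : σU2 ≤ σV2 := by
    have hV : σV2 = a1 ^ 2 := by
      rw [hσV2, ← h']
      field_simp
    have hβ' : (1 - β) ^ 2 * σ1 ^ 2 + β ^ 2 * σY ^ 2 = β * σY ^ 2 := by
      rw [hβ]
      field_simp
      ring
    rw [hV, hσU2, div_le_iff₀ hDpos, ← h', ← hβ']
    nlinarith [mul_le_mul_of_nonneg_left h (by positivity : 0 ≤ β ^ 2 * σY ^ 2)]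
  refine ⟨hmain, fun h => hmain (hbayes (h.2 ▸ h.1.ge) h.1), fun h => hmain (hbayes h.1 h.2),
    fun ⟨h12, h2Y, h⟩ => hmain ?_⟩
  have hβ' : β = 1 / 2 := by
    rw [hβ, h12, h2Y]
    field_simp
    norm_num
  rw [hσU2, hσV2, hβ', mul_assoc _ (a1 ^ 2), h12, ← h2Y, div_le_div_iff₀ (by positivity)
    (by positivity)]
  nlinarith [mul_le_mul_of_nonneg_left h (by positivity : 0 ≤ σ2 ^ 2 * σ2 ^ 2)]

end
end
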